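/- arXiv:2307.07759 — 2 statements merged into one kernel-verified Lean document; each statement's English description precedes it below -/
import Mathlib

section
/- Let X be a compact metric space, μ a finite nonzero Borel measure on X, F : X → ℝ a continuous function, and x₀ a point of the support of μ such that F(x) > F(x₀) for every x in the support of μ with x ≠ x₀ (i.e. F attains a strict unique minimum on supp μ at x₀). Then for every continuous function g : X → ℝ, lim_{t → ∞} (∫_X g e^{−tF} dμ) / (∫_X e^{−tF} dμ) = g(x₀). -/
open MeasureTheory Filter

/-- The support of a Borel measure: the set of points all of whose neighborhoods have
positive measure. -/
def measureSupport {X : Type*} [TopologicalSpace X] [MeasurableSpace X]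
    (μ : Measure X) : Set X :=
  {x : X | ∀ U ∈ nhds x, 0 < μ U}

/-- A continuous function with a strict unique minimum over a compact set is bounded away from
its minimum outside any neighborhood of the minimizer. -/
theorem IsCompact.exists_gap_of_unique_min {X : Type*} [TopologicalSpace X] {S : Set X}
    (hS : IsCompact S) {F : X → ℝ} (hF : Continuous F) {x₀ : X}
    (hmin : ∀ x ∈ S, x ≠ x₀ → F x₀ < F x) {U : Set X} (hU : IsOpen U) (hx₀ : x₀ ∈ U) :
    ∃ m, F x₀ < m ∧ ∀ x ∈ S, x ∉ U → m ≤ F x := by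
  rcases (S \ U).eq_empty_or_nonempty with h | h
  · refine ⟨F x₀ + 1, by linarith, fun x hx hxU => ?_⟩
    have hmem : x ∈ S \ U := ⟨hx, hxU⟩
    simp [h] at hmem
  · obtain ⟨y, hy, hymin⟩ := (hS.diff hU).exists_isMinOn h hF.continuousOn
    refine ⟨F y, hmin y hy.1 fun he => hy.2 (he ▸ hx₀), fun x hx hxU => hymin ⟨hx, hxU⟩⟩

/-- A Laplace integral is bounded below by its contribution from a sublevel set. -/
theorem exp_mul_measureReal_le_integral_exp {X : Type*} [MeasurableSpace X] {μ : Measure X}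
    [IsFiniteMeasure μ] {F : X → ℝ} (hF : Measurable F) {t : ℝ} (ht : 0 ≤ t) (a : ℝ)
    (hint : Integrable (fun x => Real.exp (-t * F x)) μ) :
    Real.exp (-t * a) * μ.real {x | F x < a} ≤ ∫ x, Real.exp (-t * F x) ∂μ := by
  have hV : MeasurableSet {x | F x < a} := measurableSet_lt hF measurable_const
  calc Real.exp (-t * a) * μ.real {x | F x < a}
      = ∫ x in {x | F x < a}, Real.exp (-t * a) ∂μ := by
        rw [setIntegral_const, smul_eq_mul, mul_comm]
    _ ≤ ∫ x in {x | F x < a}, Real.exp (-t * F x) ∂μ := by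
        refine setIntegral_mono_on (integrable_const _) hint.integrableOn hV fun x hx => ?_
        have hx' : F x < a := hx
        exact Real.exp_le_exp.2 (by nlinarith)
    _ ≤ ∫ x, Real.exp (-t * F x) ∂μ :=
        setIntegral_le_integral hint (ae_of_all _ fun x => (Real.exp_pos _).le)

/-- Laplace-type concentration: if `F` is continuous on a compact metric space `X`, `μ` is
a finite nonzero Borel measure, and `F` attains a strict unique minimum on `supp μ` at
`x₀ ∈ supp μ`, then for every continuous `g`,
`(∫ g e^{−tF} dμ) / (∫ e^{−tF} dμ) → g(x₀)` as `t → ∞`. -/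
theorem laplace_concentration
    {X : Type*} [MetricSpace X] [CompactSpace X]
    [MeasurableSpace X] [BorelSpace X]
    (μ : Measure X) [IsFiniteMeasure μ] (hμ : μ ≠ 0)
    (F : X → ℝ) (hF : Continuous F)
    (x₀ : X) (hx₀ : x₀ ∈ measureSupport μ)
    (hmin : ∀ x ∈ measureSupport μ, x ≠ x₀ → F x₀ < F x)
    (g : X → ℝ) (hg : Continuous g) :
    Tendsto
      (fun t : ℝ =>
        (∫ x, g x * Real.exp (-t * F x) ∂μ) / ∫ x, Real.exp (-t * F x) ∂μ)
      atTop (nhds (g x₀)) := by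
  have hcont : ∀ t : ℝ, Continuous fun x => Real.exp (-t * F x) := fun t => by fun_prop
  have hint : ∀ f : X → ℝ, Continuous f → Integrable f μ := fun f hf =>
    hf.integrable_of_hasCompactSupport (HasCompactSupport.of_compactSpace f)
  have hsupp : measureSupport μ = μ.support := by
    ext x
    exact (Measure.mem_support_iff_forall x).symm
  rw [hsupp] at hmin
  have hae : ∀ᵐ x ∂μ, x ∈ μ.support := Measure.support_mem_ae
  obtain ⟨M, hM⟩ : ∃ M, ∀ x, |g x - g x₀| ≤ M := by
    obtain ⟨M, hM⟩ := isCompact_univ.exists_bound_of_continuousOn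
      (f := fun x => g x - g x₀) (by fun_prop)
    exact ⟨M, fun x => hM x (Set.mem_univ x)⟩
  have hM0 : 0 ≤ M := (abs_nonneg _).trans (hM x₀)
  rw [Metric.tendsto_nhds]
  intro ε hε
  obtain ⟨m, hm, hmF⟩ := Measure.isClosed_support.isCompact.exists_gap_of_unique_min hF hmin
    (U := {x | |g x - g x₀| < ε / 2}) (isOpen_lt (by fun_prop) continuous_const)
    (by simpa using hε)
  obtain ⟨a, ha, ham⟩ := exists_between hm
  set c := μ.real {x | F x < a} with hc
  have hc0 : 0 < c := ENNReal.toReal_pos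
    (hx₀ _ ((isOpen_lt hF continuous_const).mem_nhds ha)).ne' (measure_ne_top _ _)
  have hlim : Tendsto (fun t : ℝ => M * μ.real Set.univ / c * Real.exp (-(t * (m - a))))
      atTop (nhds 0) := by
    simpa using (Real.tendsto_exp_neg_atTop_nhds_zero.comp
      (tendsto_id.atTop_mul_const (sub_pos.2 ham))).const_mul (M * μ.real Set.univ / c)
  filter_upwards [eventually_ge_atTop 0, hlim.eventually_lt_const (half_pos hε)] with t ht hsmall
  have hD := exp_mul_measureReal_le_integral_exp hF.measurable ht a (hint _ (hcont t))
  rw [← hc] at hD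
  set D := ∫ x, Real.exp (-t * F x) ∂μ with hDdef
  have hDpos : 0 < D := (by positivity : 0 < Real.exp (-t * a) * c).trans_le hD
  have hnum : (∫ x, g x * Real.exp (-t * F x) ∂μ) - g x₀ * D
      = ∫ x, (g x - g x₀) * Real.exp (-t * F x) ∂μ := by
    rw [hDdef, ← integral_const_mul, ← integral_sub (hint _ (by fun_prop))
      (hint _ (by fun_prop))]
    simp only [sub_mul]
  have hbound : |∫ x, (g x - g x₀) * Real.exp (-t * F x) ∂μ|
      ≤ ε / 2 * D + M * Real.exp (-t * m) * μ.real Set.univ := by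
    calc |∫ x, (g x - g x₀) * Real.exp (-t * F x) ∂μ|
        ≤ ∫ x, (ε / 2 * Real.exp (-t * F x) + M * Real.exp (-t * m)) ∂μ := by
          rw [← Real.norm_eq_abs]
          refine norm_integral_le_of_norm_le (hint _ (by fun_prop)) ?_
          filter_upwards [hae] with x hx
          rw [Real.norm_eq_abs, abs_mul, abs_of_pos (Real.exp_pos _)]
          by_cases hxU : |g x - g x₀| < ε / 2
          · have h₁ := mul_le_mul_of_nonneg_right hxU.le (Real.exp_pos (-t * F x)).le
            have h₂ : 0 ≤ M * Real.exp (-t * m) := by positivity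
            linarith
          · have hmx : m ≤ F x := hmF x hx hxU
            have h₁ : |g x - g x₀| * Real.exp (-t * F x) ≤ M * Real.exp (-t * m) :=
              mul_le_mul (hM x) (Real.exp_le_exp.2 (by nlinarith)) (Real.exp_pos _).le hM0
            have h₂ : 0 ≤ ε / 2 * Real.exp (-t * F x) := by positivity
            linarith
      _ = ε / 2 * D + M * Real.exp (-t * m) * μ.real Set.univ := by
          rw [integral_add (hint _ (by fun_prop)) (integrable_const _), integral_const_mul,
            integral_const, smul_eq_mul, mul_comm (μ.real Set.univ)]
  have htail : M * Real.exp (-t * m) * μ.real Set.univ < ε / 2 * D := by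
    calc M * Real.exp (-t * m) * μ.real Set.univ
        = M * μ.real Set.univ / c * Real.exp (-(t * (m - a))) * (Real.exp (-t * a) * c) := by
          have he : Real.exp (-t * m) = Real.exp (-(t * (m - a))) * Real.exp (-t * a) := by
            rw [← Real.exp_add]
            ring_nf
          rw [he]
          field_simp
      _ < ε / 2 * (Real.exp (-t * a) * c) := mul_lt_mul_of_pos_right hsmall (by positivity)
      _ ≤ ε / 2 * D := mul_le_mul_of_nonneg_left hD (half_pos hε).le
  rw [Real.dist_eq, div_sub' hDpos.ne', abs_div, abs_of_pos hDpos, div_lt_iff₀ hDpos,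
    mul_comm D, hnum]
  linarith
end

section
/- Let A be a commutative Banach algebra over ℂ and D : A → A a ℂ-linear derivation (D(ab) = D(a)b + aD(b) for all a, b ∈ A). Let t ∈ ℂ and f, g ∈ A be such that the series Σ_{k≥0} (|t|^k / k!) ‖D^k f‖ and Σ_{k≥0} (|t|^k / k!) ‖D^k g‖ both converge. Then the series Σ_{k≥0} (|t|^k / k!) ‖D^k (fg)‖ also converges, and Σ_{k≥0} (t^k / k!) D^k(fg) = (Σ_{k≥0} (t^k / k!) D^k f) · (Σ_{k≥0} (t^k / k!) D^k g). -/
open Finset in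
/-- The general Leibniz rule for the iterates of a derivation. -/
theorem LinearMap.pow_apply_mul_of_leibniz {R A : Type*} [Semiring R] [Semiring A] [Module R A]
    (D : A →ₗ[R] A) (hD : ∀ a b : A, D (a * b) = D a * b + a * D b) (f g : A) (n : ℕ) :
    (D ^ n) (f * g) =
      ∑ p ∈ antidiagonal n, n.choose p.1 • ((D ^ p.1) f * (D ^ p.2) g) := by
  induction n with
  | zero => simp
  | succ n ih =>
    rw [sum_antidiagonal_choose_succ_nsmul (fun i j => (D ^ i) f * (D ^ j) g) n, pow_succ',
      Module.End.mul_apply, ih, map_sum, ← sum_add_distrib]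
    refine sum_congr rfl fun p hp => ?_
    rw [Nat.choose_symm_of_eq_add (mem_antidiagonal.1 hp).symm, map_nsmul, hD, pow_succ' D p.1,
      pow_succ' D p.2, Module.End.mul_apply, Module.End.mul_apply, ← nsmul_add, add_comm]

open Finset in
/-- The coefficients of the Lie series of a product are the Cauchy product of the coefficients
of the Lie series of the factors. -/
theorem LinearMap.lie_series_coeff_mul {𝕜 A : Type*} [Field 𝕜] [CharZero 𝕜] [Semiring A]
    [Algebra 𝕜 A] (D : A →ₗ[𝕜] A) (hD : ∀ a b : A, D (a * b) = D a * b + a * D b)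
    (t : 𝕜) (f g : A) (n : ℕ) :
    (t ^ n / (Nat.factorial n : 𝕜)) • (D ^ n) (f * g) =
      ∑ p ∈ antidiagonal n, ((t ^ p.1 / (Nat.factorial p.1 : 𝕜)) • (D ^ p.1) f) *
        ((t ^ p.2 / (Nat.factorial p.2 : 𝕜)) • (D ^ p.2) g) := by
  rw [D.pow_apply_mul_of_leibniz hD, smul_sum]
  refine sum_congr rfl fun p hp => ?_
  obtain rfl := mem_antidiagonal.1 hp
  rw [smul_mul_smul_comm, ← Nat.cast_smul_eq_nsmul 𝕜, smul_smul, Nat.cast_add_choose]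
  congr 1
  have h : (Nat.factorial (p.1 + p.2) : 𝕜) ≠ 0 := Nat.cast_ne_zero.2 (Nat.factorial_ne_zero _)
  have h₁ : (Nat.factorial p.1 : 𝕜) ≠ 0 := Nat.cast_ne_zero.2 (Nat.factorial_ne_zero _)
  have h₂ : (Nat.factorial p.2 : 𝕜) ≠ 0 := Nat.cast_ne_zero.2 (Nat.factorial_ne_zero _)
  field_simp
  ring


/-- Multiplicative property of Lie series: if `D` is a derivation on a commutative Banach
algebra `A` over `ℂ` and the Lie series of `f` and `g` at time `t` converge absolutely,
then so does the Lie series of `fg`, and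
`Σ (tᵏ/k!) Dᵏ(fg) = (Σ (tᵏ/k!) Dᵏf) · (Σ (tᵏ/k!) Dᵏg)`. -/
theorem lie_series_mul
    {A : Type*} [NormedCommRing A] [NormedAlgebra ℂ A] [CompleteSpace A]
    (D : A →ₗ[ℂ] A) (hD : ∀ a b : A, D (a * b) = D a * b + a * D b)
    (t : ℂ) (f g : A)
    (hf : Summable fun k : ℕ => ‖t‖ ^ k / (Nat.factorial k : ℝ) * ‖(D ^ k) f‖)
    (hg : Summable fun k : ℕ => ‖t‖ ^ k / (Nat.factorial k : ℝ) * ‖(D ^ k) g‖) :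
    (Summable fun k : ℕ => ‖t‖ ^ k / (Nat.factorial k : ℝ) * ‖(D ^ k) (f * g)‖) ∧
      (∑' k : ℕ, (t ^ k / (Nat.factorial k : ℂ)) • (D ^ k) (f * g)) =
        (∑' k : ℕ, (t ^ k / (Nat.factorial k : ℂ)) • (D ^ k) f) *
          ∑' k : ℕ, (t ^ k / (Nat.factorial k : ℂ)) • (D ^ k) g := by
  have norm_coeff (h : A) (k : ℕ) : ‖t‖ ^ k / (Nat.factorial k : ℝ) * ‖(D ^ k) h‖ =
      ‖(t ^ k / (Nat.factorial k : ℂ)) • (D ^ k) h‖ := by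
    rw [norm_smul, norm_div, norm_pow, Complex.norm_natCast]
  rw [funext (norm_coeff f)] at hf
  rw [funext (norm_coeff g)] at hg
  rw [funext (norm_coeff (f * g)), tsum_mul_tsum_eq_tsum_sum_antidiagonal_of_summable_norm hf hg,
    funext (D.lie_series_coeff_mul hD t f g)]
  refine ⟨?_, rfl⟩
  convert summable_norm_sum_mul_antidiagonal_of_summable_norm hf hg using 2 with k
  rw [D.lie_series_coeff_mul hD t f g]
end
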